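/- arXiv:0808.1788 — 3 statements merged into one kernel-verified Lean document; each statement's English description precedes it below -/
import Mathlib

section
/- For every integer n ≥ 2 and every ε > 0 there exists a body K ⊂ ℝⁿ (a compact set with nonempty interior) that is of class K₁^ε but not of class K₂^ε. -/
open Metric Set

section CylindricalProfile

variable {E : Type*} [NormedAddCommGroup E] [InnerProductSpace ℝ E]

/-- Squared Euclidean distance between two points of the plane. -/
def planeSqDist (p q : ℝ × ℝ) : ℝ := (p.1 - q.1) ^ 2 + (p.2 - q.2) ^ 2

/-- Cylindrical coordinates of `x`: its distance to the axis `ℝ e` and its height along `e`. -/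
noncomputable def cylProfile (e x : E) : ℝ × ℝ := (‖x - inner ℝ e x • e‖, inner ℝ e x)

lemma continuous_cylProfile (e : E) : Continuous (cylProfile e) := by
  unfold cylProfile
  fun_prop

lemma norm_sq_eq_perp_add {e : E} (he : ‖e‖ = 1) (x : E) :
    ‖x‖ ^ 2 = ‖x - inner ℝ e x • e‖ ^ 2 + (inner ℝ e x) ^ 2 := by
  rw [norm_sub_sq_real, norm_smul, he, inner_smul_right, real_inner_comm, Real.norm_eq_abs,
    mul_one, sq_abs]
  ring

lemma norm_sq_eq_cylProfile {e : E} (he : ‖e‖ = 1) (x : E) :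
    ‖x‖ ^ 2 = (cylProfile e x).1 ^ 2 + (cylProfile e x).2 ^ 2 :=
  norm_sq_eq_perp_add he x

lemma planeSqDist_cylProfile_le {e : E} (he : ‖e‖ = 1) (x z : E) :
    planeSqDist (cylProfile e x) (cylProfile e z) ≤ ‖x - z‖ ^ 2 := by
  rw [norm_sq_eq_perp_add he (x - z)]
  have h := abs_norm_sub_norm_le (x - inner ℝ e x • e) (z - inner ℝ e z • e)
  have heq : x - z - inner ℝ e (x - z) • e
      = (x - inner ℝ e x • e) - (z - inner ℝ e z • e) := by
    rw [inner_sub_right, sub_smul]; abel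
  have h2 := sq_le_sq' (by linarith [neg_abs_le (‖x - inner ℝ e x • e‖ - ‖z - inner ℝ e z • e‖)])
    ((le_abs_self _).trans h)
  simp only [planeSqDist, cylProfile]
  rw [heq, inner_sub_right]
  linarith

/-- Any profile point can be lifted into the half-plane through a given `x`, where the
profile map is isometric. -/
lemma exists_cylProfile_eq {e f : E} (he : ‖e‖ = 1) (hf : ‖f‖ = 1) (hef : inner ℝ e f = 0)
    (x : E) {q : ℝ × ℝ} (hq : 0 ≤ q.1) :
    ∃ c, cylProfile e c = q ∧ ‖x - c‖ ^ 2 = planeSqDist (cylProfile e x) q := by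
  set y := x - inner ℝ e x • e with hy
  obtain ⟨g, hg, heg, hyg⟩ : ∃ g : E, ‖g‖ = 1 ∧ inner ℝ e g = 0 ∧ y = ‖y‖ • g := by
    by_cases h0 : y = 0
    · exact ⟨f, hf, hef, by simp [h0]⟩
    · have hn : ‖y‖ ≠ 0 := norm_ne_zero_iff.2 h0
      refine ⟨‖y‖⁻¹ • y, ?_, ?_, ?_⟩
      · rw [norm_smul, norm_inv, norm_norm, inv_mul_cancel₀ hn]
      · rw [inner_smul_right, hy, inner_sub_right, inner_smul_right,
          real_inner_self_eq_norm_sq, he]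
        ring
      · rw [smul_smul, mul_inv_cancel₀ hn, one_smul]
  have hin : inner ℝ e (q.1 • g + q.2 • e) = q.2 := by
    rw [inner_add_right, inner_smul_right, inner_smul_right, heg,
      real_inner_self_eq_norm_sq, he]
    ring
  refine ⟨q.1 • g + q.2 • e, ?_, ?_⟩
  · apply Prod.ext
    · simp only [cylProfile]
      rw [hin, add_sub_cancel_right, norm_smul, hg, mul_one, Real.norm_of_nonneg hq]
    · exact hin
  · have h1 : x - (q.1 • g + q.2 • e) - inner ℝ e (x - (q.1 • g + q.2 • e)) • e
        = (‖y‖ - q.1) • g := by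
      rw [inner_sub_right, hin, sub_smul, sub_smul, ← hyg, hy]
      abel
    rw [norm_sq_eq_perp_add he, h1, inner_sub_right, hin, norm_smul, hg, mul_one,
      Real.norm_eq_abs, sq_abs]
    rfl

end CylindricalProfile

/-- Vertices of an equilateral triangle of side `2 r` in the right half-plane. -/
noncomputable def discCenter (r : ℝ) : Fin 3 → ℝ × ℝ :=
  ![(r, r), (r, -r), (r + √3 * r, 0)]

/-- The open triangle spanned by the disc centers. -/
def openTriangle (r : ℝ) : Set (ℝ × ℝ) :=
  {p | r < p.1 ∧ √3 * p.2 + (p.1 - r) < √3 * r ∧ -(√3 * p.2) + (p.1 - r) < √3 * r}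

/-- The closed triangle spanned by the disc centers. -/
def closedTriangle (r : ℝ) : Set (ℝ × ℝ) :=
  {p | r ≤ p.1 ∧ √3 * p.2 + (p.1 - r) ≤ √3 * r ∧ -(√3 * p.2) + (p.1 - r) ≤ √3 * r}

/-- Three mutually tangent open discs of radius `r` together with the triangle of their centers. -/
def cavity (r : ℝ) : Set (ℝ × ℝ) :=
  {p | ∃ i, planeSqDist p (discCenter r i) < r ^ 2} ∪ openTriangle r

/-- The closed version of `cavity`. -/
def closedCavity (r : ℝ) : Set (ℝ × ℝ) :=
  {p | ∃ i, planeSqDist p (discCenter r i) ≤ r ^ 2} ∪ closedTriangle r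

lemma continuous_planeSqDist_left (q : ℝ × ℝ) : Continuous fun p => planeSqDist p q := by
  unfold planeSqDist
  fun_prop

lemma isOpen_cavity (r : ℝ) : IsOpen (cavity r) := by
  refine IsOpen.union ?_ ?_
  · rw [ofPred_exists]
    exact isOpen_iUnion fun i => isOpen_lt (continuous_planeSqDist_left _) continuous_const
  · unfold openTriangle
    simp only [ofPred_and]
    exact (isOpen_lt (by fun_prop) (by fun_prop)).inter
      ((isOpen_lt (by fun_prop) (by fun_prop)).inter (isOpen_lt (by fun_prop) (by fun_prop)))

lemma isClosed_closedCavity (r : ℝ) : IsClosed (closedCavity r) := by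
  refine IsClosed.union ?_ ?_
  · rw [ofPred_exists]
    exact isClosed_iUnion_of_finite fun i =>
      isClosed_le (continuous_planeSqDist_left _) continuous_const
  · unfold closedTriangle
    simp only [ofPred_and]
    exact (isClosed_le (by fun_prop) (by fun_prop)).inter
      ((isClosed_le (by fun_prop) (by fun_prop)).inter (isClosed_le (by fun_prop) (by fun_prop)))

lemma cavity_subset_closedCavity (r : ℝ) : cavity r ⊆ closedCavity r := by
  rintro p (⟨i, hi⟩ | ⟨h1, h2, h3⟩)
  · exact Or.inl ⟨i, hi.le⟩
  · exact Or.inr ⟨h1.le, h2.le, h3.le⟩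

/-- The boundary of the cavity is covered by the three closed discs. -/
lemma exists_mem_disc_of_mem_closedCavity {r : ℝ} {p : ℝ × ℝ}
    (hp : p ∈ closedCavity r) (hp' : p ∉ cavity r) :
    ∃ i, planeSqDist p (discCenter r i) ≤ r ^ 2 := by
  rcases hp with hp | ⟨h1, h2, h3⟩
  · exact hp
  obtain ⟨u, t⟩ := p
  simp only at h1 h2 h3
  have hs : √3 ^ 2 = 3 := Real.sq_sqrt (by norm_num)
  have hs0 : 0 < √3 := by positivity
  have hT : ¬ (r < u ∧ √3 * t + (u - r) < √3 * r ∧ -(√3 * t) + (u - r) < √3 * r) :=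
    fun h => hp' (Or.inr h)
  have key : r = u ∨ √3 * t + (u - r) = √3 * r ∨ -(√3 * t) + (u - r) = √3 * r := by
    by_contra! hne
    exact hT ⟨lt_of_le_of_ne h1 hne.1, lt_of_le_of_ne h2 hne.2.1, lt_of_le_of_ne h3 hne.2.2⟩
  rcases key with h | h | h
  · have ha : t ≤ r := le_of_mul_le_mul_left (by linarith) hs0
    have hb : -r ≤ t := le_of_mul_le_mul_left (by linarith) hs0
    rcases le_total 0 t with ht | ht
    · exact ⟨0, by simp only [planeSqDist, discCenter, Matrix.cons_val]; subst h; nlinarith⟩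
    · exact ⟨1, by simp only [planeSqDist, discCenter, Matrix.cons_val]; subst h; nlinarith⟩
  · have hu : u = r + √3 * (r - t) := by linarith
    subst hu
    have ha : t ≤ r := le_of_mul_le_mul_left (by linarith) hs0
    have hb : 0 ≤ t := le_of_mul_le_mul_left (by linarith) hs0
    rcases le_total (r / 2) t with ht | ht
    · refine ⟨0, ?_⟩
      simp only [planeSqDist, discCenter, Matrix.cons_val]
      have : (r + √3 * (r - t) - r) ^ 2 + (t - r) ^ 2 = √3 ^ 2 * (r - t) ^ 2 + (t - r) ^ 2 := by
        ring
      rw [this, hs]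
      nlinarith
    · refine ⟨2, ?_⟩
      simp only [planeSqDist, discCenter, Matrix.cons_val]
      have : (r + √3 * (r - t) - (r + √3 * r)) ^ 2 + (t - 0) ^ 2 = √3 ^ 2 * t ^ 2 + t ^ 2 := by
        ring
      rw [this, hs]
      nlinarith
  · have hu : u = r + √3 * (r + t) := by linarith
    subst hu
    have ha : -r ≤ t := le_of_mul_le_mul_left (by linarith) hs0
    have hb : t ≤ 0 := le_of_mul_le_mul_left (by linarith) hs0
    rcases le_total t (-r / 2) with ht | ht
    · refine ⟨1, ?_⟩
      simp only [planeSqDist, discCenter, Matrix.cons_val]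
      have : (r + √3 * (r + t) - r) ^ 2 + (t - -r) ^ 2 = √3 ^ 2 * (r + t) ^ 2 + (t + r) ^ 2 := by
        ring
      rw [this, hs]
      nlinarith
    · refine ⟨2, ?_⟩
      simp only [planeSqDist, discCenter, Matrix.cons_val]
      have : (r + √3 * (r + t) - (r + √3 * r)) ^ 2 + (t - 0) ^ 2 = √3 ^ 2 * t ^ 2 + t ^ 2 := by
        ring
      rw [this, hs]
      nlinarith

/-- The centroid of the triangle of disc centers. -/
noncomputable def cavityCentroid (r : ℝ) : ℝ × ℝ := (r + √3 * r / 3, 0)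

lemma cavityCentroid_mem {r : ℝ} (hr : 0 < r) : cavityCentroid r ∈ cavity r := by
  have hs0 : 0 < √3 * r := by positivity
  right
  refine ⟨?_, ?_, ?_⟩ <;> simp only [cavityCentroid] <;> linarith

lemma notMem_closedCavity {r u t : ℝ} (h₁ : r ^ 2 < (u - r) ^ 2 + (t - r) ^ 2)
    (h₂ : r ^ 2 < (u - r) ^ 2 + (t + r) ^ 2) (h₃ : r ^ 2 < (u - (r + √3 * r)) ^ 2 + t ^ 2)
    (h : u < r ∨ √3 * r < √3 * t + (u - r) ∨ √3 * r < -(√3 * t) + (u - r)) :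
    (u, t) ∉ closedCavity r := by
  rintro (⟨i, hi⟩ | ⟨g₁, g₂, g₃⟩)
  · fin_cases i <;> simp [planeSqDist, discCenter] at hi <;> linarith
  · simp only at g₁ g₂ g₃
    rcases h with h | h | h <;> linarith

/-- Every closed disc of radius `r` containing the centroid reaches outside the closed cavity. -/
lemma exists_notMem_closedCavity {r : ℝ} (hr : 0 < r) {c : ℝ × ℝ}
    (hc : planeSqDist (cavityCentroid r) c ≤ r ^ 2) :
    ∃ v : ℝ × ℝ, 0 ≤ v.1 ∧ v.1 ^ 2 + v.2 ^ 2 < (10 * r) ^ 2 ∧ v ∉ closedCavity r ∧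
      planeSqDist c v ≤ r ^ 2 := by
  obtain ⟨u, t⟩ := c
  have hs : √3 ^ 2 = 3 := Real.sq_sqrt (by norm_num)
  have hk0 : 0 ≤ √3 := Real.sqrt_nonneg 3
  have hk1 : 1.7 < √3 := by nlinarith
  have hk2 : √3 < 1.8 := by nlinarith
  have hl : 1.7 * r < √3 * r := by gcongr
  have hu : √3 * r < 1.8 * r := by gcongr
  have ha : (√3 * r) ^ 2 = 3 * r ^ 2 := by rw [mul_pow, hs]
  have hb : (√3 * t) ^ 2 = 3 * t ^ 2 := by rw [mul_pow, hs]
  have hab : √3 * (√3 * r) = 3 * r := by rw [← mul_assoc, ← sq, hs]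
  have hab' : √3 * r * t = r * (√3 * t) := by ring
  have hb0 : 0 ≤ t → 0 ≤ √3 * t := fun h => by positivity
  have hb1 : t ≤ 0 → √3 * t ≤ 0 := fun h => mul_nonpos_of_nonneg_of_nonpos hk0 h
  have hvert : √3 * (√3 * r / 2) = 3 * r / 2 := by linarith
  have hvert' : √3 * -(√3 * r / 2) = -(3 * r / 2) := by linarith
  have hcav : ∀ y, y = √3 * r / 2 ∨ y = -(√3 * r / 2) →
      (r + √3 * r / 3 + r / 2, y) ∉ closedCavity r := by
    rintro y (rfl | rfl)
    · refine notMem_closedCavity ?_ ?_ ?_ (Or.inr (Or.inl ?_))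
      · nlinarith
      · nlinarith
      · nlinarith
      · rw [hvert]; linarith
    · refine notMem_closedCavity ?_ ?_ ?_ (Or.inr (Or.inr ?_))
      · nlinarith
      · nlinarith
      · nlinarith
      · rw [hvert']; linarith
  have hcav' : (√3 * r / 3, 0) ∉ closedCavity r := by
    refine notMem_closedCavity ?_ ?_ ?_ (Or.inl ?_) <;> nlinarith
  obtain ⟨x, rfl⟩ : ∃ x, u = r + √3 * r / 3 + x := ⟨u - (r + √3 * r / 3), by ring⟩
  have hc' : x ^ 2 + t ^ 2 ≤ r ^ 2 := by
    simp only [planeSqDist, cavityCentroid] at hc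
    linarith
  have of_le_sq : ∀ m : ℝ, 0 ≤ m → x ^ 2 + t ^ 2 ≤ m ^ 2 → x ^ 2 + t ^ 2 ≤ m * r := by
    intro m hm hle
    rcases le_total m r with h | h <;> nlinarith
  simp only [planeSqDist]
  generalize √3 * r = a at *
  generalize √3 * t = b at *
  by_cases h1 : 3 * x ≤ b ∧ 3 * x ≤ -b
  · have hx : 0 ≤ -2 * x := by linarith [h1.1, h1.2]
    have := of_le_sq (-2 * x) hx
      (by nlinarith [mul_nonneg (sub_nonneg.2 h1.1) (sub_nonneg.2 h1.2)])
    exact ⟨(a / 3, 0), by linarith, by nlinarith [sq_pos_of_pos hr], hcav', by linarith⟩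
  · rcases le_total 0 t with ht | ht
    · have hbt := hb0 ht
      have hx : -b < 3 * x := by
        by_contra! hx
        exact h1 ⟨by linarith, hx⟩
      have := of_le_sq (x + b) (by linarith)
        (by nlinarith [mul_nonneg hbt (by linarith : 0 ≤ 3 * x + b)])
      exact ⟨(r + a / 3 + r / 2, a / 2), by linarith, by nlinarith, hcav _ (Or.inl rfl),
        by linarith⟩
    · have hbt := hb1 ht
      have hx : b < 3 * x := by
        by_contra! hx
        exact h1 ⟨hx, by linarith⟩
      have := of_le_sq (x - b) (by linarith)
        (by nlinarith [mul_nonneg (neg_nonneg.2 hbt) (by linarith : 0 ≤ 3 * x - b)])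
      exact ⟨(r + a / 3 + r / 2, -(a / 2)), by linarith, by nlinarith, hcav _ (Or.inr rfl),
        by linarith⟩

lemma inter_eq_empty_of_ball {E : Type*} [NormedAddCommGroup E] [NormedSpace ℝ E]
    {c : E} {r : ℝ} (hr : r ≠ 0) {V : Set E} (hV : IsOpen V) (h : Disjoint (ball c r) V) :
    closedBall c r ∩ V = ∅ := by
  rw [← closure_ball c hr]
  exact (h.closure_left hV).inter_eq

/-- The ball of radius `10 r` with the rotated cavity removed. -/
def hollowBody {E : Type*} [NormedAddCommGroup E] [InnerProductSpace ℝ E] (e : E) (r : ℝ) :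
    Set E :=
  closedBall 0 (10 * r) ∩ (cylProfile e ⁻¹' cavity r)ᶜ

section HollowBody

variable {E : Type*} [NormedAddCommGroup E] [InnerProductSpace ℝ E] {e f : E} {r : ℝ}

lemma isClosed_hollowBody (e : E) (r : ℝ) : IsClosed (hollowBody e r) :=
  isClosed_closedBall.inter ((isOpen_cavity r).preimage (continuous_cylProfile e)).isClosed_compl

lemma mem_interior_hollowBody {x : E} (hx : ‖x‖ < 10 * r) (hx' : cylProfile e x ∉ closedCavity r) :
    x ∈ interior (hollowBody e r) := by
  refine mem_interior.2 ⟨ball 0 (10 * r) ∩ (cylProfile e ⁻¹' closedCavity r)ᶜ, ?_, ?_, ?_⟩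
  · rintro z ⟨h1, h2⟩
    exact ⟨ball_subset_closedBall h1, fun h => h2 (cavity_subset_closedCavity r h)⟩
  · exact isOpen_ball.inter
      ((isClosed_closedCavity r).preimage (continuous_cylProfile e)).isOpen_compl
  · exact ⟨by simpa using hx, hx'⟩

lemma exists_outer_support_ball_hollowBody (he : ‖e‖ = 1) (hf : ‖f‖ = 1) (hef : inner ℝ e f = 0)
    (hr : 0 < r) {x : E} (hx : x ∈ frontier (hollowBody e r)) :
    ∃ C, x ∈ closedBall C r ∧ closedBall C r ∩ interior (hollowBody e r) = ∅ ∧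
      (closedBall C r ∩ hollowBody e r).Nonempty := by
  have hxK : x ∈ hollowBody e r := (isClosed_hollowBody e r).frontier_subset hx
  suffices h : ∃ C, x ∈ closedBall C r ∧ Disjoint (ball C r) (interior (hollowBody e r)) by
    obtain ⟨C, h1, h2⟩ := h
    exact ⟨C, h1, inter_eq_empty_of_ball hr.ne' isOpen_interior h2, x, h1, hxK⟩
  have hxR : ‖x‖ ≤ 10 * r := by simpa using hxK.1
  rcases hxR.lt_or_eq with hlt | heq
  · have hcl : cylProfile e x ∈ closedCavity r := by
      by_contra hn
      exact hx.2 (mem_interior_hollowBody hlt hn)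
    obtain ⟨i, hi⟩ := exists_mem_disc_of_mem_closedCavity hcl hxK.2
    have hpos : 0 ≤ (discCenter r i).1 := by
      fin_cases i <;> simp [discCenter] <;> positivity
    obtain ⟨C, hC, hxC⟩ := exists_cylProfile_eq he hf hef x hpos
    refine ⟨C, ?_, ?_⟩
    · rw [mem_closedBall, dist_eq_norm]
      exact le_of_sq_le_sq (hxC ▸ hi) hr.le
    · refine Set.disjoint_left.2 fun z hz hzK => (interior_subset hzK).2 (Or.inl ⟨i, ?_⟩)
      rw [mem_ball, dist_eq_norm] at hz
      rw [← hC]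
      exact (planeSqDist_cylProfile_le he z C).trans_lt
        (pow_lt_pow_left₀ hz (norm_nonneg _) two_ne_zero)
  · refine ⟨(11 / 10 : ℝ) • x, ?_, ?_⟩
    · rw [mem_closedBall, dist_eq_norm, show x - (11 / 10 : ℝ) • x = (-(1 / 10) : ℝ) • x by module,
        norm_smul, heq]
      norm_num
      linarith
    · refine Set.disjoint_left.2 fun z hz hzK => ?_
      have hzR : ‖z‖ ≤ 10 * r := by simpa using (interior_subset hzK).1
      rw [mem_ball, dist_comm, dist_eq_norm] at hz
      have h1 := norm_sub_norm_le ((11 / 10 : ℝ) • x) z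
      rw [norm_smul, heq] at h1
      norm_num at h1
      linarith

lemma exists_cylProfile_eq_cavityCentroid (he : ‖e‖ = 1) (hf : ‖f‖ = 1) (hef : inner ℝ e f = 0)
    (hr : 0 < r) : ∃ x, cylProfile e x = cavityCentroid r := by
  have hpos : 0 ≤ (cavityCentroid r).1 := by
    simp only [cavityCentroid]; positivity
  obtain ⟨x, hx, -⟩ := exists_cylProfile_eq he hf hef 0 hpos
  exact ⟨x, hx⟩

lemma closedBall_inter_interior_hollowBody_nonempty (he : ‖e‖ = 1) (hf : ‖f‖ = 1)
    (hef : inner ℝ e f = 0) (hr : 0 < r) {x C : E} (hx : cylProfile e x = cavityCentroid r)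
    (hC : x ∈ closedBall C r) : (closedBall C r ∩ interior (hollowBody e r)).Nonempty := by
  rw [mem_closedBall, dist_eq_norm] at hC
  have h1 : planeSqDist (cavityCentroid r) (cylProfile e C) ≤ r ^ 2 :=
    hx ▸ (planeSqDist_cylProfile_le he x C).trans (pow_le_pow_left₀ (norm_nonneg _) hC 2)
  obtain ⟨v, hv0, hvR, hv, hvC⟩ := exists_notMem_closedCavity hr h1
  obtain ⟨z, hz, hCz⟩ := exists_cylProfile_eq he hf hef C hv0
  refine ⟨z, ?_, mem_interior_hollowBody ?_ (hz ▸ hv)⟩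
  · rw [mem_closedBall, dist_comm, dist_eq_norm]
    exact le_of_sq_le_sq (hCz ▸ hvC) hr.le
  · refine lt_of_pow_lt_pow_left₀ 2 (by positivity) ?_
    rw [norm_sq_eq_cylProfile he, hz]
    exact hvR

end HollowBody

/-- For every `n ≥ 2` and every `ε > 0` there is a body
`K ⊂ ℝⁿ` of class `K₁^ε` (every boundary point lies in an outer support ball of
radius `1/ε`) that is not of class `K₂^ε` (some point outside `K` lies in no
closed ball of radius `1/ε` disjoint from the interior of `K`). -/
theorem exists_body_K1_not_K2 (n : ℕ) (hn : 2 ≤ n) (ε : ℝ) (hε : 0 < ε) :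
    ∃ K : Set (EuclideanSpace ℝ (Fin n)),
      IsCompact K ∧ (interior K).Nonempty ∧
      (∀ x ∈ frontier K, ∃ C : EuclideanSpace ℝ (Fin n),
          x ∈ Metric.closedBall C (1 / ε) ∧
          Metric.closedBall C (1 / ε) ∩ interior K = ∅ ∧
          (Metric.closedBall C (1 / ε) ∩ K).Nonempty) ∧
      ¬ (∀ x ∉ K, ∃ C : EuclideanSpace ℝ (Fin n),
          x ∈ Metric.closedBall C (1 / ε) ∧
          Metric.closedBall C (1 / ε) ∩ interior K = ∅) := by
  have hr : 0 < 1 / ε := by positivity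
  generalize 1 / ε = r at hr
  set e : EuclideanSpace ℝ (Fin n) := EuclideanSpace.single ⟨0, by omega⟩ 1
  set f : EuclideanSpace ℝ (Fin n) := EuclideanSpace.single ⟨1, by omega⟩ 1
  have he : ‖e‖ = 1 := by simp [e]
  have hf : ‖f‖ = 1 := by simp [f]
  have hef : inner ℝ e f = 0 := by
    simp [e, f, EuclideanSpace.inner_single_left]
  obtain ⟨x, hx⟩ := exists_cylProfile_eq_cavityCentroid he hf hef hr
  refine ⟨hollowBody e r, ?_, ?_, fun y hy => ?_, fun h => ?_⟩
  · exact (isCompact_closedBall 0 (10 * r)).of_isClosed_subset (isClosed_hollowBody e r)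
      inter_subset_left
  · exact (closedBall_inter_interior_hollowBody_nonempty he hf hef hr hx
      (mem_closedBall_self hr.le)).mono inter_subset_right
  · exact exists_outer_support_ball_hollowBody he hf hef hr hy
  · have hxK : x ∉ hollowBody e r := fun hK =>
      hK.2 (show cylProfile e x ∈ cavity r from hx ▸ cavityCentroid_mem hr)
    obtain ⟨C, hC, hempty⟩ := h x hxK
    exact (closedBall_inter_interior_hollowBody_nonempty he hf hef hr hx hC).ne_empty hempty
end

section
/- For every integer n ≥ 3 and every ε > 0 there exists a body K ⊂ ℝⁿ (a compact set with nonempty interior) that is of class K₂^ε but not of class K₃^ε. -/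
open Metric Set

section TwoHoledBall

variable {V : Type*} [NormedAddCommGroup V]

/-- The closed ball of radius `M` around the origin with the open balls of radius `R` around
`c` and `-c` removed. -/
def twoHoledBall (c : V) (M R : ℝ) : Set V :=
  closedBall 0 M \ (ball c R ∪ ball (-c) R)

theorem isCompact_twoHoledBall [ProperSpace V] (c : V) (M R : ℝ) :
    IsCompact (twoHoledBall c M R) :=
  (isCompact_closedBall 0 M).diff (isOpen_ball.union isOpen_ball)

theorem mem_interior_twoHoledBall {c x : V} {M R : ℝ} (hx : ‖x‖ < M) (h₁ : R < ‖x - c‖)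
    (h₂ : R < ‖x + c‖) : x ∈ interior (twoHoledBall c M R) := by
  have hopen : IsOpen (ball (0 : V) M \ (closedBall c R ∪ closedBall (-c) R)) :=
    isOpen_ball.sdiff (isClosed_closedBall.union isClosed_closedBall)
  refine interior_maximal ?_ hopen ?_
  · exact sdiff_subset_sdiff ball_subset_closedBall
      (union_subset_union ball_subset_closedBall ball_subset_closedBall)
  · simp [dist_eq_norm, hx, h₁, h₂]

variable [InnerProductSpace ℝ V]

/-- A closed ball whose open ball misses `s` also misses the interior of `s`. -/
theorem closedBall_inter_interior_eq_empty {s : Set V} {c : V} {R : ℝ} (hR : R ≠ 0)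
    (h : Disjoint (ball c R) s) : closedBall c R ∩ interior s = ∅ := by
  rw [← closure_ball c hR, ← disjoint_iff_inter_eq_empty]
  exact (h.mono_right interior_subset).closure_left isOpen_interior

theorem closedBall_inter_interior_twoHoledBall (c : V) (M : ℝ) {R : ℝ} (hR : R ≠ 0) :
    closedBall c R ∩ interior (twoHoledBall c M R) = ∅ :=
  closedBall_inter_interior_eq_empty hR <|
    disjoint_left.2 fun _ hx hK => hK.2 (Or.inl hx)

theorem closedBall_neg_inter_interior_twoHoledBall (c : V) (M : ℝ) {R : ℝ} (hR : R ≠ 0) :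
    closedBall (-c) R ∩ interior (twoHoledBall c M R) = ∅ :=
  closedBall_inter_interior_eq_empty hR <|
    disjoint_left.2 fun _ hx hK => hK.2 (Or.inr hx)

/-- A point outside a centered ball lies in a closed ball of prescribed radius missing it. -/
theorem exists_closedBall_disjoint_closedBall_zero {x : V} {M R : ℝ} (hM : 0 ≤ M) (hR : 0 ≤ R)
    (hx : M < ‖x‖) : ∃ C : V, x ∈ closedBall C R ∧ Disjoint (closedBall C R) (closedBall 0 M) := by
  have hx0 : 0 < ‖x‖ := hM.trans_lt hx
  have hnorm : ‖(R / ‖x‖) • x‖ = R := by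
    rw [norm_smul, Real.norm_of_nonneg (by positivity), div_mul_cancel₀ _ hx0.ne']
  have hC : ‖x + (R / ‖x‖) • x‖ = ‖x‖ + R := by
    rw [show x + (R / ‖x‖) • x = (1 + R / ‖x‖) • x by module, norm_smul,
      Real.norm_of_nonneg (by positivity)]
    field_simp
  refine ⟨x + (R / ‖x‖) • x, by simp [dist_eq_norm, hnorm], closedBall_disjoint_closedBall ?_⟩
  rw [dist_zero_right, hC]
  linarith

theorem exists_closedBall_of_notMem_twoHoledBall {c x : V} {M R : ℝ} (hM : 0 ≤ M) (hR : 0 < R)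
    (hx : x ∉ twoHoledBall c M R) :
    ∃ C : V, x ∈ closedBall C R ∧ closedBall C R ∩ interior (twoHoledBall c M R) = ∅ := by
  by_cases hxM : x ∈ closedBall 0 M
  · have hballs : x ∈ ball c R ∪ ball (-c) R := by
      by_contra h
      exact hx ⟨hxM, h⟩
    rcases hballs with h | h
    · exact ⟨c, ball_subset_closedBall h, closedBall_inter_interior_twoHoledBall c M hR.ne'⟩
    · exact ⟨-c, ball_subset_closedBall h, closedBall_neg_inter_interior_twoHoledBall c M hR.ne'⟩
  · obtain ⟨C, hxC, hC⟩ := exists_closedBall_disjoint_closedBall_zero hM hR.le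
      (by simpa using hxM : M < ‖x‖)
    exact ⟨C, hxC, disjoint_iff_inter_eq_empty.1
      (hC.mono_right (interior_subset.trans sdiff_subset))⟩

/-- The ball around the origin whose radius `h` satisfies `h² + ‖c‖² ≤ R²` is covered by the
two closed balls of radius `R` around `c` and `-c`. -/
theorem closedBall_zero_inter_interior_twoHoledBall {c : V} {M R h : ℝ} (hR : 0 < R)
    (hh : h ^ 2 + ‖c‖ ^ 2 ≤ R ^ 2) : closedBall 0 h ∩ interior (twoHoledBall c M R) = ∅ := by
  refine eq_empty_of_forall_notMem fun z ⟨hz, hzK⟩ => ?_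
  have hzh : ‖z‖ ^ 2 ≤ h ^ 2 := by
    gcongr
    simpa using hz
  rcases le_total 0 (inner ℝ z c) with hi | hi
  · refine (closedBall_inter_interior_twoHoledBall c M hR.ne').le ⟨?_, hzK⟩
    rw [mem_closedBall, dist_eq_norm]
    refine le_of_pow_le_pow_left₀ two_ne_zero hR.le ?_
    rw [norm_sub_sq_real]
    linarith
  · refine (closedBall_neg_inter_interior_twoHoledBall c M hR.ne').le ⟨?_, hzK⟩
    rw [mem_closedBall, dist_eq_norm, sub_neg_eq_add]
    refine le_of_pow_le_pow_left₀ two_ne_zero hR.le ?_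
    rw [norm_add_sq_real]
    linarith

/-- The center of a ball of radius `R` containing the ball of radius `h` around the origin
has norm at most `R - h`. -/
theorem norm_add_le_of_closedBall_zero_subset {C : V} {h R : ℝ} (hh : 0 ≤ h) (hR : h ≤ R)
    (hsub : closedBall 0 h ⊆ closedBall C R) : ‖C‖ + h ≤ R := by
  rcases eq_or_ne C 0 with rfl | hC
  · simpa using hR
  have hC0 : 0 < ‖C‖ := norm_pos_iff.2 hC
  have hmem : -((h / ‖C‖) • C) ∈ closedBall (0 : V) h := by
    rw [mem_closedBall, dist_zero_right, norm_neg, norm_smul,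
      Real.norm_of_nonneg (by positivity), div_mul_cancel₀ _ hC0.ne']
  have hle := hsub hmem
  have hrw : -((h / ‖C‖) • C) - C = -((1 + h / ‖C‖) • C) := by
    module
  rw [mem_closedBall, dist_eq_norm, hrw, norm_neg, norm_smul,
    Real.norm_of_nonneg (by positivity)] at hle
  convert hle using 1
  field_simp

variable {e f : V} {u : ℝ}

theorem norm_smul_sub_smul_sq (he : ‖e‖ = 1) (hf : ‖f‖ = 1) (hfe : inner ℝ f e = 0) (s t : ℝ) :
    ‖s • f - t • e‖ ^ 2 = s ^ 2 + t ^ 2 := by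
  rw [norm_sub_sq_real, real_inner_smul_left, real_inner_smul_right, hfe, norm_smul, norm_smul,
    he, hf]
  simp

theorem smul_mem_interior_twoHoledBall (he : ‖e‖ = 1) (hf : ‖f‖ = 1) (hfe : inner ℝ f e = 0)
    (hu : 0 < u) :
    (4 * u) • f ∈ interior (twoHoledBall ((4 * u) • e) (10 * u) (5 * u)) := by
  refine mem_interior_twoHoledBall ?_ ?_ ?_
  · rw [norm_smul, hf, Real.norm_of_nonneg (by positivity)]
    linarith
  · refine lt_of_pow_lt_pow_left₀ 2 (norm_nonneg _) ?_
    rw [norm_smul_sub_smul_sq he hf hfe]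
    nlinarith
  · refine lt_of_pow_lt_pow_left₀ 2 (norm_nonneg _) ?_
    rw [← sub_neg_eq_add, ← neg_smul, norm_smul_sub_smul_sq he hf hfe]
    nlinarith

theorem smul_mem_twoHoledBall (he : ‖e‖ = 1) (hf : ‖f‖ = 1) (hfe : inner ℝ f e = 0)
    (hu : 0 < u) :
    (3 * u) • f ∈ twoHoledBall ((4 * u) • e) (10 * u) (5 * u) := by
  refine ⟨?_, ?_⟩
  · rw [mem_closedBall, dist_zero_right, norm_smul, hf, Real.norm_of_nonneg (by positivity)]
    linarith
  · rw [mem_union, mem_ball, mem_ball, dist_eq_norm, dist_eq_norm, ← neg_smul, not_or, not_lt,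
      not_lt]
    constructor <;> refine le_of_pow_le_pow_left₀ two_ne_zero (norm_nonneg _) ?_ <;>
      rw [norm_smul_sub_smul_sq he hf hfe] <;> nlinarith

/-- No ball of radius `5 * u` containing the ball of radius `3 * u` around the origin misses the
interior of the two-holed ball. -/
theorem closedBall_inter_interior_twoHoledBall_nonempty (he : ‖e‖ = 1) (hf : ‖f‖ = 1)
    (hfe : inner ℝ f e = 0) (hu : 0 < u) {C : V}
    (hsub : closedBall 0 (3 * u) ⊆ closedBall C (5 * u)) :
    (closedBall C (5 * u) ∩
      interior (twoHoledBall ((4 * u) • e) (10 * u) (5 * u))).Nonempty := by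
  wlog hi : 0 ≤ inner ℝ f C generalizing f
  · exact this (f := -f) (by rwa [norm_neg]) (by rw [inner_neg_left, hfe, neg_zero])
      (by rw [inner_neg_left]; linarith)
  refine ⟨(4 * u) • f, ?_, smul_mem_interior_twoHoledBall he hf hfe hu⟩
  have hC : ‖C‖ + 3 * u ≤ 5 * u :=
    norm_add_le_of_closedBall_zero_subset (by positivity) (by linarith) hsub
  rw [mem_closedBall, dist_eq_norm]
  refine le_of_pow_le_pow_left₀ two_ne_zero (by positivity) ?_
  rw [norm_sub_sq_real, real_inner_smul_left, norm_smul, hf,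
    Real.norm_of_nonneg (by positivity)]
  have h4 : 0 ≤ 4 * u * inner ℝ f C := by positivity
  nlinarith [norm_nonneg C]

end TwoHoledBall

/-- For every `n ≥ 3` and every `ε > 0` there is a body
`K ⊂ ℝⁿ` of class `K₂^ε` (every point outside `K` lies in a closed ball of
radius `1/ε` disjoint from the interior of `K`) that is not of class `K₃^ε`
(some outer support ball of radius `r < 1/ε` is contained in no outer support
ball of radius `1/ε`). -/
theorem exists_body_K2_not_K3 (n : ℕ) (hn : 3 ≤ n) (ε : ℝ) (hε : 0 < ε) :
    ∃ K : Set (EuclideanSpace ℝ (Fin n)),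
      IsCompact K ∧ (interior K).Nonempty ∧
      (∀ x ∉ K, ∃ C : EuclideanSpace ℝ (Fin n),
          x ∈ Metric.closedBall C (1 / ε) ∧
          Metric.closedBall C (1 / ε) ∩ interior K = ∅) ∧
      ¬ (∀ (C : EuclideanSpace ℝ (Fin n)) (r : ℝ), r < 1 / ε →
          (Metric.closedBall C r ∩ interior K = ∅ ∧
            (Metric.closedBall C r ∩ K).Nonempty) →
          ∃ C' : EuclideanSpace ℝ (Fin n),
            (Metric.closedBall C' (1 / ε) ∩ interior K = ∅ ∧
              (Metric.closedBall C' (1 / ε) ∩ K).Nonempty) ∧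
            Metric.closedBall C r ⊆ Metric.closedBall C' (1 / ε)) := by
  obtain ⟨u, hu, huε⟩ : ∃ u : ℝ, 0 < u ∧ 1 / ε = 5 * u := ⟨1 / ε / 5, by positivity, by ring⟩
  let i : Fin n := ⟨0, by lia⟩
  let j : Fin n := ⟨1, by lia⟩
  obtain ⟨e, f, he, hf, hfe⟩ : ∃ e f : EuclideanSpace ℝ (Fin n),
      ‖e‖ = 1 ∧ ‖f‖ = 1 ∧ inner ℝ f e = 0 :=
    ⟨EuclideanSpace.single i 1, EuclideanSpace.single j 1, by simp, by simp,
      by simp [i, j, EuclideanSpace.inner_single_left]⟩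
  have hR : 0 < 5 * u := by positivity
  rw [huε]
  refine ⟨twoHoledBall ((4 * u) • e) (10 * u) (5 * u), isCompact_twoHoledBall _ _ _,
    ⟨_, smul_mem_interior_twoHoledBall he hf hfe hu⟩,
    fun x hx => exists_closedBall_of_notMem_twoHoledBall (by positivity) hR hx, fun hK => ?_⟩
  have hcover : (3 * u) ^ 2 + ‖(4 * u) • e‖ ^ 2 ≤ (5 * u) ^ 2 := by
    rw [norm_smul, he, Real.norm_of_nonneg (by positivity)]
    nlinarith
  have htouch : (3 * u) • f ∈ closedBall (0 : EuclideanSpace ℝ (Fin n)) (3 * u) := by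
    rw [mem_closedBall, dist_zero_right, norm_smul, hf, Real.norm_of_nonneg (by positivity),
      mul_one]
  obtain ⟨C, ⟨hdisj, -⟩, hsub⟩ := hK 0 (3 * u) (by linarith)
    ⟨closedBall_zero_inter_interior_twoHoledBall hR hcover,
      ⟨_, htouch, smul_mem_twoHoledBall he hf hfe hu⟩⟩
  exact (closedBall_inter_interior_twoHoledBall_nonempty he hf hfe hu hsub).ne_empty hdisj
end

section
/- Let n ≥ 2, ε > 0, and let K ⊂ ℝⁿ be a connected body (a compact connected set with nonempty interior) of class K₁^ε whose diameter d_K satisfies ε·d_K ≤ 1. Then the boundary of K is connected. -/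
open Metric Set

/-- Simply connected, locally path connected normal spaces are unicoherent. -/
theorem IsPreconnected.inter_of_union_eq_univ {X : Type*} [TopologicalSpace X] [NormalSpace X]
    [SimplyConnectedSpace X] [LocallyPathConnectedSpace X] {P Q : Set X}
    (hP : IsPreconnected P) (hQ : IsPreconnected Q) (hPc : IsClosed P) (hQc : IsClosed Q)
    (hPQ : P ∪ Q = univ) : IsPreconnected (P ∩ Q) := by
  classical
  rw [isPreconnected_iff_subset_of_fully_disjoint_closed (hPc.inter hQc)]
  intro u v hu hv huv hd
  by_contra! ⟨hnu, hnv⟩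
  obtain ⟨b, hb, hbu⟩ := not_subset.1 hnu
  obtain ⟨a, ha, hav⟩ := not_subset.1 hnv
  have hbv : b ∈ v := (huv hb).resolve_left hbu
  have hau : a ∈ u := (huv ha).resolve_right hav
  obtain ⟨g, hg0, hg1, -⟩ := exists_continuous_zero_one_of_isClosed hu hv hd
  have hcP : Continuous fun x => Circle.exp (Real.pi * g x) := by fun_prop
  have hcQ : Continuous fun x => Circle.exp (-(Real.pi * g x)) := by fun_prop
  let f : X → Circle := P.piecewise (fun x => Circle.exp (Real.pi * g x))
    (fun x => Circle.exp (-(Real.pi * g x)))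
  have hfP : EqOn f (fun x => Circle.exp (Real.pi * g x)) P := piecewise_eqOn _ _ _
  have hfQ : EqOn f (fun x => Circle.exp (-(Real.pi * g x))) Q := by
    intro x hxQ
    by_cases hxP : x ∈ P
    · rw [hfP hxP]
      rcases huv ⟨hxP, hxQ⟩ with hx | hx
      · simp [hg0 hx]
      · ext
        simp [hg1 hx, Circle.exp_neg]
    · exact piecewise_eq_of_notMem _ _ _ hxP
  have hf : Continuous f := by
    rw [← continuousOn_univ, ← hPQ]
    exact (hcP.continuousOn.congr hfP).union_of_isClosed (hcQ.continuousOn.congr hfQ) hPc hQc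
  obtain ⟨F, ⟨hFa, hF⟩, -⟩ := Circle.isCoveringMap_exp.existsUnique_continuousMap_lifts
    ⟨f, hf⟩ a 0 (by simp [hfP ha.1, hg0 hau])
  have hFP : EqOn F (fun x => Real.pi * g x) P := by
    refine Circle.isCoveringMap_exp.eqOn_of_comp_eqOn hP F.continuous.continuousOn
      (by fun_prop) (fun x hx => ?_) ha.1 (by simp [hFa, hg0 hau])
    rw [hF]
    exact hfP hx
  have hFQ : EqOn F (fun x => -(Real.pi * g x)) Q := by
    refine Circle.isCoveringMap_exp.eqOn_of_comp_eqOn hQ F.continuous.continuousOn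
      (by fun_prop) (fun x hx => ?_) ha.2 (by simp [hFa, hg0 hau])
    rw [hF]
    exact hfQ hx
  have h := (hFP hb.1).symm.trans (hFQ hb.2)
  simp only [hg1 hbv, Pi.one_apply, mul_one] at h
  linarith [Real.pi_pos]

section NormedSpace

variable {E : Type*} [NormedAddCommGroup E] [NormedSpace ℝ E] {K : Set E} {x C : E} {R : ℝ}

/-- A closed ball containing a point `x` of `K`, disjoint from the interior of `K` and of radius
at least the diameter of `K`, contains the start of a ray from `x` that avoids `interior K`. -/
theorem exists_ray_subset_compl_interior [Nontrivial E] (hK : Bornology.IsBounded K)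
    (hx : x ∈ K) (hR : diam K ≤ R) (hxC : x ∈ closedBall C R)
    (hC : closedBall C R ∩ interior K = ∅) :
    ∃ u : E, ‖u‖ = 1 ∧ ∀ t : ℝ, 0 ≤ t → x + t • u ∈ (interior K)ᶜ := by
  obtain ⟨u, hu, hCu⟩ : ∃ u : E, ‖u‖ = 1 ∧ C = x + ‖C - x‖ • u := by
    by_cases h : C = x
    · obtain ⟨u, hu⟩ := exists_norm_eq E zero_le_one
      exact ⟨u, hu, by simp [h]⟩
    · have h' : ‖C - x‖ ≠ 0 := norm_ne_zero_iff.2 (sub_ne_zero.2 h)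
      refine ⟨‖C - x‖⁻¹ • (C - x), ?_, ?_⟩
      · rw [norm_smul, norm_inv, norm_norm, inv_mul_cancel₀ h']
      · rw [smul_inv_smul₀ h', add_sub_cancel]
  refine ⟨u, hu, fun t ht hmem => ?_⟩
  rcases le_or_gt t R with htR | htR
  · refine eq_empty_iff_forall_notMem.1 hC (x + t • u) ⟨?_, hmem⟩
    have hs : ‖C - x‖ ≤ R := by rwa [mem_closedBall, dist_comm, dist_eq_norm] at hxC
    have hs0 := norm_nonneg (C - x)
    generalize ‖C - x‖ = s at *
    rw [mem_closedBall, hCu, dist_add_left, dist_eq_norm, ← sub_smul, norm_smul, hu, mul_one,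
      Real.norm_eq_abs, abs_le]
    constructor <;> linarith
  · have h := dist_le_diam_of_mem hK (interior_subset hmem) hx
    rw [dist_self_add_left, norm_smul, hu, mul_one, Real.norm_eq_abs, abs_of_nonneg ht] at h
    linarith

/-- The ball around `y` of radius the distance from `y` to `K` avoids the interior of `K`. -/
theorem closedBall_infDist_subset_compl_interior {y : E} (hy : y ∉ interior K) :
    closedBall y (infDist y K) ⊆ (interior K)ᶜ := by
  intro z hz hzK
  rcases eq_or_ne (infDist y K) 0 with h | h
  · rw [h, closedBall_zero, mem_singleton_iff] at hz
    exact hy (hz ▸ hzK)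
  · rw [← closure_ball y h] at hz
    obtain ⟨w, hwK, hw⟩ := mem_closure_iff.1 hz _ isOpen_interior hzK
    rw [mem_ball, dist_comm] at hw
    exact (infDist_le_dist_of_mem (interior_subset hwK)).not_gt hw

theorem isPreconnected_compl_interior_of_outer_balls (hE : 1 < Module.rank ℝ E)
    (hK : IsCompact K) (hKne : K.Nonempty) (hR : diam K ≤ R)
    (hK1 : ∀ x ∈ frontier K, ∃ C, x ∈ closedBall C R ∧ closedBall C R ∩ interior K = ∅) :
    IsPreconnected (interior K)ᶜ := by
  have : Nontrivial E := (rank_pos_iff_nontrivial (R := ℝ)).1 (zero_lt_one.trans hE)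
  obtain ⟨ρ, hρ0, hρ⟩ := hK.isBounded.subset_ball_lt 0 (0 : E)
  have hS : sphere (0 : E) ρ ⊆ (interior K)ᶜ := fun z hz hzK =>
    (mem_ball.1 (hρ (interior_subset hzK))).ne hz
  obtain ⟨p, hp⟩ := NormedSpace.sphere_nonempty (x := (0 : E)) |>.2 hρ0.le
  refine isPreconnected_of_forall p fun y hy => ?_
  obtain ⟨x, hxK, hx⟩ := hK.exists_infDist_eq_dist hKne y
  have hball := closedBall_infDist_subset_compl_interior hy
  have hxball : x ∈ closedBall y (infDist y K) := by rw [mem_closedBall, hx, dist_comm]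
  have hyball : y ∈ closedBall y (infDist y K) := mem_closedBall_self infDist_nonneg
  obtain ⟨C, hxC, hC⟩ := hK1 x ⟨subset_closure hxK, hball hxball⟩
  obtain ⟨u, hu, hray⟩ := exists_ray_subset_compl_interior hK.isBounded hxK hR hxC hC
  let γ : ℝ → E := fun t => x + t • u
  have hγ : Continuous γ := by fun_prop
  have hγp : IsPreconnected (γ '' Ici 0) := isPreconnected_Ici.image _ hγ.continuousOn
  have hγx : x ∈ γ '' Ici 0 := ⟨0, self_mem_Ici, by simp [γ]⟩
  have hxρ : ‖x‖ < ρ := by simpa using hρ hxK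
  obtain ⟨t, ht, htρ⟩ : ρ ∈ (fun t => ‖γ t‖) '' Ici 0 := by
    refine isPreconnected_Ici.intermediate_value (a := 0) (b := 2 * ρ) self_mem_Ici
      (by simp [hρ0.le]) hγ.norm.continuousOn ⟨by simpa [γ] using hxρ.le, ?_⟩
    have h := norm_sub_le (γ (2 * ρ)) x
    have h2 : ‖γ (2 * ρ) - x‖ = 2 * ρ := by
      simp [γ, norm_smul, hu, abs_of_pos hρ0]
    linarith
  refine ⟨sphere 0 ρ ∪ (γ '' Ici 0 ∪ closedBall y (infDist y K)), ?_, .inl hp,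
    .inr (.inr hyball), ?_⟩
  · refine union_subset hS (union_subset ?_ hball)
    rintro _ ⟨s, hs, rfl⟩
    exact hray s hs
  · exact (isPreconnected_sphere hE 0 ρ).union (γ t) (by simpa using htρ)
      (.inl (mem_image_of_mem γ ht)) (hγp.union x hγx hxball isPreconnected_closedBall)

end NormedSpace

/-- A connected body `K ⊂ ℝⁿ` (`n ≥ 2`) of class `K₁^ε` with
`ε · d_K ≤ 1` has connected boundary. -/
theorem small_K1_body_frontier_connected {n : ℕ} (hn : 2 ≤ n) {ε : ℝ} (hε : 0 < ε)
    (K : Set (EuclideanSpace ℝ (Fin n)))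
    (hKc : IsCompact K) (hKconn : IsConnected K) (hKint : (interior K).Nonempty)
    (hsmall : ε * Metric.diam K ≤ 1)
    (hK1 : ∀ x ∈ frontier K, ∃ C : EuclideanSpace ℝ (Fin n),
        x ∈ Metric.closedBall C (1 / ε) ∧
        Metric.closedBall C (1 / ε) ∩ interior K = ∅ ∧
        (Metric.closedBall C (1 / ε) ∩ K).Nonempty) :
    IsConnected (frontier K) := by
  have hrank : 1 < Module.rank ℝ (EuclideanSpace ℝ (Fin n)) := by
    rw [← Module.finrank_eq_rank, finrank_euclideanSpace_fin]
    exact_mod_cast hn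
  have : Nontrivial (EuclideanSpace ℝ (Fin n)) :=
    (rank_pos_iff_nontrivial (R := ℝ)).1 (zero_lt_one.trans hrank)
  refine ⟨nonempty_frontier_iff.2 ⟨hKconn.nonempty, hKc.ne_univ⟩, ?_⟩
  have hcompl : IsPreconnected (interior K)ᶜ := by
    refine isPreconnected_compl_interior_of_outer_balls hrank hKc hKconn.nonempty
      (R := 1 / ε) ?_ fun x hx => ?_
    · rwa [le_div_iff₀ hε, mul_comm]
    · obtain ⟨C, hxC, hC, -⟩ := hK1 x hx
      exact ⟨C, hxC, hC⟩
  rw [hKc.isClosed.frontier_eq, sdiff_eq]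
  refine hKconn.isPreconnected.inter_of_union_eq_univ hcompl hKc.isClosed
    isOpen_interior.isClosed_compl (eq_univ_of_forall fun x => ?_)
  by_cases hx : x ∈ interior K
  · exact .inl (interior_subset hx)
  · exact .inr hx
end
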